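/- arXiv:2310.04235 — 3 statements merged into one kernel-verified Lean document; each statement's English description precedes it below -/
import Mathlib

section
/- Let S be an LEF semigroup, let n ≥ 2, and let x, y ∈ S satisfy (y*x)*(x*y)^n = (y*x)^n. Then there exists a positive integer m with m < n² + 2n and n ∤ m such that (y*x)²*(x*y)^m = (y*x)*(x*y)^m*(y*x). -/
/-- A semigroup `S` is LEF if for every finite subset `H` of `S` there exist a finite
semigroup `F` and a function `f : S → F` injective on `H` such that
`f (x * y) = f x * f y` whenever `x, y, x * y ∈ H`. -/
def IsLEF (S : Type*) [Semigroup S] : Prop :=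
  ∀ H : Finset S, ∃ (F : Type) (_ : Semigroup F) (_ : Fintype F) (f : S → F),
    Set.InjOn f ↑H ∧
      ∀ x ∈ H, ∀ y ∈ H, x * y ∈ H → f (x * y) = f x * f y

/-- Positive powers in a semigroup: `sPow x n = x ^ (n + 1)`, so that for `k ≥ 1` the
`k`-th power `x ^ k` is `sPow x (k - 1)`. -/
def sPow {S : Type*} [Semigroup S] (x : S) : ℕ → S
  | 0 => x
  | n + 1 => sPow x n * x

section Monoid

variable {M : Type*} [Monoid M]

/-- Shifting an eventually periodic sequence of powers by multiples of its period. -/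
theorem pow_add_mul_period {a : M} {N p : ℕ} (h : a ^ (N + p) = a ^ N) {j : ℕ} (hj : N ≤ j)
    (t : ℕ) : a ^ (j + t * p) = a ^ j := by
  induction t with
  | zero => simp
  | succ t ih =>
    obtain ⟨d, rfl⟩ := Nat.exists_eq_add_of_le hj
    rw [show N + d + (t + 1) * p = (N + p) + (d + t * p) by ring, pow_add, h, ← pow_add,
      ← add_assoc, ih]

/-- The least eventual period of `a` divides every eventual period. -/
theorem minimal_period_dvd {a : M} {N p : ℕ} (hp : 0 < p) (h : a ^ (N + p) = a ^ N)
    (hmin : ∀ q, 0 < q → a ^ (N + q) = a ^ N → p ≤ q) {j q : ℕ}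
    (hq : a ^ (j + q) = a ^ j) : p ∣ q := by
  have hjp : j ≤ N + j * p := by nlinarith
  have hNq : a ^ (N + q) = a ^ N := by
    have := pow_add_mul_period hq hjp 1
    rw [one_mul, pow_add_mul_period h le_rfl] at this
    rw [← this, add_right_comm, pow_add_mul_period h (Nat.le_add_right N q)]
  have hmod : a ^ (N + q % p) = a ^ N := by
    rw [← hNq, ← pow_add_mul_period h (Nat.le_add_right N (q % p)) (q / p), add_assoc,
      mul_comm (q / p), Nat.mod_add_div]
  by_contra hdvd
  have hpos : 0 < q % p := Nat.pos_of_ne_zero fun h0 => hdvd (Nat.dvd_of_mod_eq_zero h0)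
  exact absurd (hmin _ hpos hmod) (Nat.mod_lt q hp).not_ge

theorem mul_swap_pow_succ (x y : M) (k : ℕ) : (x * y) ^ (k + 1) = x * (y * x) ^ k * y := by
  induction k with
  | zero => simp
  | succ k ih => rw [pow_succ, ih, pow_succ (y * x)]; simp only [mul_assoc]

theorem mul_pow_mul_eq_pow {a b : M} {r : ℕ} (h : a * b ^ (r + 1) = a ^ (r + 1)) (k : ℕ) :
    a * b ^ (k * (r + 1)) = a ^ (k * r + 1) := by
  induction k with
  | zero => simp
  | succ k ih =>
    rw [add_mul k 1 (r + 1), one_mul, pow_add, ← mul_assoc, ih, pow_succ, mul_assoc, h, ← pow_add]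
    congr 1
    ring

theorem mul_swap_pow_periodic {x y : M} {i p : ℕ} (h : (y * x) ^ (i + p) = (y * x) ^ i) :
    (x * y) ^ (i + 1 + p) = (x * y) ^ (i + 1) := by
  rw [add_right_comm, mul_swap_pow_succ, mul_swap_pow_succ, h]

/-- The powers of `y * x` become periodic from exponent `(r + 1) ^ 2` on. -/
theorem exists_period_of_mul_pow_eq [Finite M] {x y : M} {r : ℕ} (hr : 0 < r)
    (h : (y * x) * (x * y) ^ (r + 1) = (y * x) ^ (r + 1)) :
    ∃ p, 0 < p ∧ (y * x) ^ ((r + 1) ^ 2 + p) = (y * x) ^ ((r + 1) ^ 2) := by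
  classical
  have hex : ∃ i p, 0 < p ∧ (y * x) ^ (i + p) = (y * x) ^ i := by
    obtain ⟨i, j, hij, he⟩ :=
      Finite.exists_ne_map_eq_of_infinite (fun k : ℕ => (y * x) ^ k)
    rcases lt_or_gt_of_ne hij with hlt | hlt
    · exact ⟨i, j - i, by lia, by rw [Nat.add_sub_cancel' hlt.le]; exact he.symm⟩
    · exact ⟨j, i - j, by lia, by rw [Nat.add_sub_cancel' hlt.le]; exact he⟩
  obtain ⟨p, hp, hper⟩ := Nat.find_spec hex
  set i := Nat.find hex
  suffices hle : i ≤ (r + 1) ^ 2 from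
    ⟨p, hp, by simpa using pow_add_mul_period hper hle 1⟩
  -- `k` is the ceiling of `(i + 1) / (r + 1)`.
  set k := (i + 1 + r) / (r + 1) with hk
  have hk_lower : i + 1 ≤ k * (r + 1) := by
    have := Nat.lt_div_mul_add (a := i + 1 + r) (b := r + 1) (by lia)
    rw [← hk] at this
    lia
  have hk_upper : k * (r + 1) ≤ i + 1 + r := Nat.div_mul_le_self _ _
  have hdescent : i ≤ k * r + 1 := by
    refine Nat.find_min' hex ⟨p * r, Nat.mul_pos hp hr, ?_⟩
    have hb := pow_add_mul_period (mul_swap_pow_periodic hper) hk_lower (r + 1)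
    rw [show k * (r + 1) + (r + 1) * p = (k + p) * (r + 1) by ring] at hb
    rw [← mul_pow_mul_eq_pow h, ← hb, mul_pow_mul_eq_pow h]
    congr 1
    ring
  nlinarith

theorem mul_pow_commute_of_mul_pow_eq [Finite M] {x y : M} {r : ℕ} (hr : 0 < r)
    (h : (y * x) * (x * y) ^ (r + 1) = (y * x) ^ (r + 1)) :
    (y * x) * (y * x) * (x * y) ^ ((r + 1) ^ 2 + 1) =
      (y * x) * (x * y) ^ ((r + 1) ^ 2 + 1) * (y * x) := by
  classical
  have hex := exists_period_of_mul_pow_eq hr h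
  obtain ⟨hp, hper⟩ := Nat.find_spec hex
  have hmin : ∀ q, 0 < q → (y * x) ^ ((r + 1) ^ 2 + q) = (y * x) ^ ((r + 1) ^ 2) →
      Nat.find hex ≤ q := fun q h0 hq => Nat.find_min' hex ⟨h0, hq⟩
  generalize Nat.find hex = p at hp hper hmin
  have hperb := mul_swap_pow_periodic hper
  have hcop : Nat.Coprime (r + 1) p := by
    obtain ⟨s, hs⟩ := Nat.gcd_dvd_left (r + 1) p
    obtain ⟨p', hp'⟩ := Nat.gcd_dvd_right (r + 1) p
    set g := Nat.gcd (r + 1) p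
    have hp'0 : 0 < p' := Nat.pos_of_ne_zero fun h0 => by simp [h0] at hp'; lia
    have hq : (y * x) ^ ((r + 2) * r + 1 + p' * r) = (y * x) ^ ((r + 2) * r + 1) := by
      have hb := pow_add_mul_period hperb (j := (r + 2) * (r + 1)) (by nlinarith) s
      have hexp : (r + 2) * (r + 1) + s * p = (r + 2 + p') * (r + 1) := by
        rw [hs, hp']; ring
      rw [hexp] at hb
      rw [← mul_pow_mul_eq_pow h, ← hb, mul_pow_mul_eq_pow h]
      congr 1
      ring
    have hdvd := minimal_period_dvd hp hper hmin hq
    rw [hp', mul_comm g] at hdvd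
    have hgr : g ∣ r := Nat.dvd_of_mul_dvd_mul_left hp'0 hdvd
    exact Nat.dvd_one.mp ((Nat.dvd_add_right hgr).mp (Nat.gcd_dvd_left (r + 1) p))
  obtain ⟨k, hk⟩ : ∃ k, (x * y) ^ ((r + 1) ^ 2 + 1) = (x * y) ^ (k * (r + 1)) := by
    have htot : 0 < p.totient := Nat.totient_pos.mpr hp
    set N := (r + 1) ^ 2 + 1
    have hmod : N ≡ N * (r + 1) ^ p.totient [MOD p] := by
      simpa using ((Nat.ModEq.pow_totient hcop).mul_left N).symm
    have hle : N ≤ N * (r + 1) ^ p.totient := Nat.le_mul_of_pos_right _ (by positivity)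
    obtain ⟨t, ht⟩ := (Nat.modEq_iff_dvd' hle).mp hmod
    refine ⟨N * (r + 1) ^ (p.totient - 1), ?_⟩
    rw [mul_assoc, ← pow_succ, Nat.sub_add_cancel htot,
      ← pow_add_mul_period hperb le_rfl t, mul_comm t, ← ht, Nat.add_sub_cancel' hle]
  rw [hk, mul_assoc, mul_pow_mul_eq_pow h, ← pow_succ, ← pow_succ']

end Monoid

theorem coe_sPow {S : Type*} [Semigroup S] (a : S) (k : ℕ) :
    ((sPow a k : S) : WithOne S) = (a : WithOne S) ^ (k + 1) := by
  induction k with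
  | zero => simp [sPow]
  | succ k ih => rw [sPow, WithOne.coe_mul, ih, pow_succ _ (k + 1)]

theorem sPow_commute_of_finite {F : Type*} [Semigroup F] [Finite F] {x y : F} {r : ℕ}
    (hr : 0 < r) (h : (y * x) * sPow (x * y) r = sPow (y * x) r) :
    (y * x) * (y * x) * sPow (x * y) ((r + 1) ^ 2) =
      (y * x) * sPow (x * y) ((r + 1) ^ 2) * (y * x) := by
  have : Finite (WithOne F) := inferInstanceAs (Finite (Option F))
  apply WithOne.coe_injective
  have h' := congrArg (fun s : F => (s : WithOne F)) h
  simp only [WithOne.coe_mul, coe_sPow] at h' ⊢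
  exact mul_pow_commute_of_mul_pow_eq hr h'

theorem map_sPow_of_partial_hom {S F : Type*} [Semigroup S] [Semigroup F] {H : Set S} {f : S → F}
    (hf : ∀ s ∈ H, ∀ t ∈ H, s * t ∈ H → f (s * t) = f s * f t) {a : S} {K : ℕ}
    (hH : ∀ k ≤ K, sPow a k ∈ H) : ∀ k ≤ K, f (sPow a k) = sPow (f a) k := by
  intro k hk
  induction k with
  | zero => rfl
  | succ k ih =>
    have hk' : k ≤ K := by lia
    rw [sPow, hf _ (hH k hk') a (hH 0 (Nat.zero_le K)) (hH (k + 1) hk), ih hk', sPow]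

/-- If `S` is an LEF semigroup, `n ≥ 2` and `x, y ∈ S` satisfy `(y*x)*(x*y)^n = (y*x)^n`,
then there is a positive integer `m < n² + 2n` with `n ∤ m` such that
`(y*x)²*(x*y)^m = (y*x)*(x*y)^m*(y*x)`. -/
theorem lef_power_identity (S : Type*) [Semigroup S] (hS : IsLEF S) (n : ℕ) (hn : 2 ≤ n)
    (x y : S) (h : (y * x) * sPow (x * y) (n - 1) = sPow (y * x) (n - 1)) :
    ∃ m : ℕ, 0 < m ∧ m < n ^ 2 + 2 * n ∧ ¬ n ∣ m ∧
      (y * x) * (y * x) * sPow (x * y) (m - 1) =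
        (y * x) * sPow (x * y) (m - 1) * (y * x) := by
  classical
  obtain ⟨r, rfl⟩ : ∃ r, n = r + 1 := ⟨n - 1, by lia⟩
  refine ⟨(r + 1) ^ 2 + 1, by lia, by lia, fun hdvd => ?_, ?_⟩
  · have := Nat.dvd_one.mp ((Nat.dvd_add_right (dvd_pow_self (r + 1) two_ne_zero)).mp hdvd)
    lia
  simp only [Nat.add_sub_cancel] at h ⊢
  set K := (r + 1) ^ 2 with hK
  have hrK : r ≤ K := by nlinarith
  let H : Finset S :=
    {x, y, y * x * (y * x), y * x * (y * x) * sPow (x * y) K, y * x * sPow (x * y) K,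
      y * x * sPow (x * y) K * (y * x)} ∪
    ((Finset.range (K + 1)).image (sPow (x * y)) ∪ (Finset.range (K + 1)).image (sPow (y * x)))
  obtain ⟨F, _, _, f, hinj, hf⟩ := hS H
  have hb : ∀ k ≤ K, sPow (x * y) k ∈ H := fun k hk =>
    Finset.mem_union_right _ (Finset.mem_union_left _
      (Finset.mem_image_of_mem _ (Finset.mem_range.mpr (by lia))))
  have ha : ∀ k ≤ K, sPow (y * x) k ∈ H := fun k hk =>
    Finset.mem_union_right _ (Finset.mem_union_right _
      (Finset.mem_image_of_mem _ (Finset.mem_range.mpr (by lia))))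
  have hb0 : x * y ∈ H := hb 0 (Nat.zero_le K)
  have ha0 : y * x ∈ H := ha 0 (Nat.zero_le K)
  have hx : x ∈ H := by simp [H]
  have hy : y ∈ H := by simp [H]
  have haa : y * x * (y * x) ∈ H := by simp [H]
  have haab : y * x * (y * x) * sPow (x * y) K ∈ H := by simp [H]
  have hab : y * x * sPow (x * y) K ∈ H := by simp [H]
  have haba : y * x * sPow (x * y) K * (y * x) ∈ H := by simp [H]
  have hfa : f (y * x) = f y * f x := hf _ hy _ hx ha0
  have hfb : f (x * y) = f x * f y := hf _ hx _ hy hb0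
  have hfbk := map_sPow_of_partial_hom (H := (H : Set S)) hf hb
  have hfak := map_sPow_of_partial_hom (H := (H : Set S)) hf ha
  have hF : (f y * f x) * sPow (f x * f y) r = sPow (f y * f x) r := by
    rw [← hfa, ← hfb, ← hfbk r hrK, ← hfak r hrK, ← h]
    exact (hf _ ha0 _ (hb r hrK) (h ▸ ha r hrK)).symm
  have hcomm := sPow_commute_of_finite (by lia) hF
  apply hinj haab haba
  rw [hf _ haa _ (hb K le_rfl) haab, hf _ ha0 _ ha0 haa, hf _ hab _ ha0 haba,
    hf _ ha0 _ (hb K le_rfl) hab, hfbk K le_rfl, hfa, hfb]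
  exact hcomm
end

section
/- Let n ≥ 2 and let T_n be the semigroup presented by ⟨a, b | (b*a)*(a*b)^n = (b*a)^n⟩. Then there exist x, y ∈ T_n (namely x = a, y = b) such that (y*x)*(x*y)^n = (y*x)^n, and for every positive integer m with m < n² + 2n and n ∤ m, (y*x)²*(x*y)^m ≠ (y*x)*(x*y)^m*(y*x). -/
namespace Stmt10

/-- Positive powers in a semigroup: `sPow x n = x ^ (n + 1)`, so that for `k ≥ 1` the
`k`-th power `x ^ k` is `sPow x (k - 1)`. -/
def sPow {S : Type*} [Semigroup S] (x : S) : ℕ → S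
  | 0 => x
  | n + 1 => sPow x n * x

/-- The generator `a` of the free semigroup on two generators. -/
def a : FreeSemigroup (Fin 2) := FreeSemigroup.of 0

/-- The generator `b` of the free semigroup on two generators. -/
def b : FreeSemigroup (Fin 2) := FreeSemigroup.of 1

/-- The defining relation `(b*a)*(a*b)^n = (b*a)^n`. -/
def rel (n : ℕ) : FreeSemigroup (Fin 2) → FreeSemigroup (Fin 2) → Prop :=
  fun x y => x = (b * a) * sPow (a * b) (n - 1) ∧ y = sPow (b * a) (n - 1)

/-- The semigroup `T_n = ⟨a, b ∣ (ba)(ab)^n = (ba)^n⟩`. -/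
def T (n : ℕ) : Type := (conGen (rel n)).Quotient

instance (n : ℕ) : Semigroup (T n) := Con.semigroup _

section Rewriting

variable {α : Type*} {l r : List α}

/-- One rewriting step between `l` and `r`, in either direction, inside a word. -/
inductive Step (l r : List α) : List α → List α → Prop
  | lr (s : List α) : Step l r (l ++ s) (r ++ s)
  | rl (s : List α) : Step l r (r ++ s) (l ++ s)
  | cons (x : α) {u v : List α} : Step l r u v → Step l r (x :: u) (x :: v)

/-- `Chain l r k u v`: the word `v` is reached from `u` by exactly `k` steps. -/
inductive Chain (l r : List α) : ℕ → List α → List α → Prop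
  | refl (u : List α) : Chain l r 0 u u
  | head {k : ℕ} {u v w : List α} : Step l r u v → Chain l r k v w → Chain l r (k + 1) u w

/-- The congruence on words generated by identifying `l` and `r`. -/
def Equi (l r u v : List α) : Prop := ∃ k, Chain l r k u v

theorem Step.symm {u v : List α} (h : Step l r u v) : Step l r v u := by
  induction h with
  | lr s => exact .rl s
  | rl s => exact .lr s
  | cons x _ ih => exact .cons x ih

theorem Step.append_right {u v : List α} (h : Step l r u v) (t : List α) :
    Step l r (u ++ t) (v ++ t) := by
  induction h with
  | lr s => simpa only [List.append_assoc] using Step.lr (s ++ t)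
  | rl s => simpa only [List.append_assoc] using Step.rl (s ++ t)
  | cons x _ ih => exact .cons x ih

theorem Chain.trans {i j : ℕ} {u v w : List α} (h : Chain l r i u v) (h' : Chain l r j v w) :
    Chain l r (i + j) u w := by
  induction h with
  | refl u => simpa using h'
  | @head k u v _ hs _ ih => simpa only [Nat.add_right_comm k 1 j] using (ih h').head hs

theorem Chain.symm {k : ℕ} {u v : List α} (h : Chain l r k u v) : Chain l r k v u := by
  induction h with
  | refl u => exact .refl u
  | head hs _ ih => exact ih.trans ((Chain.refl _).head hs.symm)

theorem Chain.cons {k : ℕ} {u v : List α} (x : α) (h : Chain l r k u v) :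
    Chain l r k (x :: u) (x :: v) := by
  induction h with
  | refl u => exact .refl _
  | head hs _ ih => exact ih.head (hs.cons x)

theorem Chain.append_left {k : ℕ} {u v : List α} (p : List α) (h : Chain l r k u v) :
    Chain l r k (p ++ u) (p ++ v) := by
  induction p with
  | nil => exact h
  | cons x p ih => exact ih.cons x

theorem Chain.append_right {k : ℕ} {u v : List α} (h : Chain l r k u v) (t : List α) :
    Chain l r k (u ++ t) (v ++ t) := by
  induction h with
  | refl u => exact .refl _
  | head hs _ ih => exact ih.head (hs.append_right t)

theorem Equi.refl (u : List α) : Equi l r u u := ⟨0, .refl u⟩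

theorem Equi.symm {u v : List α} : Equi l r u v → Equi l r v u := fun ⟨k, h⟩ => ⟨k, h.symm⟩

theorem Equi.trans {u v w : List α} : Equi l r u v → Equi l r v w → Equi l r u w :=
  fun ⟨_, h⟩ ⟨_, h'⟩ => ⟨_, h.trans h'⟩

theorem Equi.append {u v u' v' : List α} : Equi l r u v → Equi l r u' v' →
    Equi l r (u ++ u') (v ++ v') :=
  fun ⟨_, h⟩ ⟨_, h'⟩ => ⟨_, (h.append_right u').trans (h'.append_left v)⟩

theorem Equi.of_rel : Equi l r l r :=
  ⟨1, by simpa using (Chain.refl _).head (Step.lr (l := l) (r := r) [])⟩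

/-- Either the first letter of a word is never touched along a chain, or there is a first step at
which one side of the relation, being a prefix, is replaced by the other. -/
theorem Chain.first_letter {k : ℕ} {x : α} {u w : List α} (h : Chain l r k (x :: u) w) :
    (∃ v, w = x :: v ∧ Chain l r k u v) ∨
      ∃ i j p q u' s, i + j + 1 = k ∧ (p = l ∧ q = r ∨ p = r ∧ q = l) ∧ x :: u' = p ++ s ∧
        Chain l r i u u' ∧ Chain l r j (q ++ s) w := by
  generalize hz : x :: u = z at h
  induction h generalizing u with
  | refl z => exact .inl ⟨u, hz.symm, .refl u⟩
  | @head k z y w hs hc ih =>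
    cases hs with
    | lr s => exact .inr ⟨0, k, l, r, u, s, by omega, .inl ⟨rfl, rfl⟩, hz, .refl u, hc⟩
    | rl s => exact .inr ⟨0, k, r, l, u, s, by omega, .inr ⟨rfl, rfl⟩, hz, .refl u, hc⟩
    | @cons x' u₁ v₁ hs =>
      obtain ⟨rfl, rfl⟩ := List.cons.inj hz
      rcases ih rfl with ⟨v, hv, hc'⟩ | ⟨i, j, p, q, u', s, hk, hpq, hu, hi, hj⟩
      · exact .inl ⟨v, hv, hc'.head hs⟩
      · exact .inr ⟨i + 1, j, p, q, u', s, by omega, hpq, hu, hi.head hs, hj⟩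

theorem Chain.eq_of_nil {k : ℕ} {v : List α} (hl : l ≠ []) (hr : r ≠ [])
    (h : Chain l r k [] v) : v = [] := by
  cases h with
  | refl => rfl
  | head hs _ =>
    generalize hz : ([] : List α) = z at hs
    cases hs with
    | lr s => exact absurd (List.append_eq_nil_iff.1 hz.symm).1 hl
    | rl s => exact absurd (List.append_eq_nil_iff.1 hz.symm).1 hr
    | cons => exact absurd hz (List.cons_ne_nil _ _).symm

variable {c d : α} {ltail rtail : List α}

/-- If the two sides of the relation start with different letters, then first letters cancel,
without making chains longer. -/
theorem Chain.cancel_cons (hcd : c ≠ d) : ∀ (k : ℕ) {x : α} {u v : List α},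
    Chain (c :: ltail) (d :: rtail) k (x :: u) (x :: v) →
      ∃ j ≤ k, Chain (c :: ltail) (d :: rtail) j u v := by
  intro k
  induction k using Nat.strong_induction_on with
  | _ k ih =>
    intro x u v h
    have cancel : ∀ (p : List α) {i : ℕ} {s t : List α}, i < k →
        Chain (c :: ltail) (d :: rtail) i (p ++ s) (p ++ t) →
          ∃ j ≤ i, Chain (c :: ltail) (d :: rtail) j s t := by
      intro p
      induction p with
      | nil => exact fun _ h => ⟨_, le_rfl, h⟩
      | cons y p ihp =>
        intro i s t hi h
        obtain ⟨j, hj, h⟩ := ih i hi h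
        obtain ⟨j', hj', h⟩ := ihp (hj.trans_lt hi) h
        exact ⟨j', hj'.trans hj, h⟩
    rcases h.first_letter with ⟨v', hv, hc⟩ | ⟨i, j, p, q, u', s, hk, hpq, hu, hi, hj⟩
    · obtain ⟨-, rfl⟩ := List.cons.inj hv
      exact ⟨k, le_rfl, hc⟩
    · rcases hpq with ⟨rfl, rfl⟩ | ⟨rfl, rfl⟩ <;>
      · obtain ⟨rfl, rfl⟩ := List.cons.inj hu
        rcases hj.first_letter with
          ⟨v', hv, -⟩ | ⟨i', j', p', q', t, s', hk', hpq', hu', hi', hj'⟩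
        · exact absurd (List.cons.inj hv).1 (by tauto)
        · rcases hpq' with ⟨rfl, rfl⟩ | ⟨rfl, rfl⟩ <;>
          first
          | exact absurd (List.cons.inj hu').1 (by tauto)
          | obtain ⟨-, rfl⟩ := List.cons.inj hu'
            obtain ⟨m₁, hm₁, h₁⟩ := cancel _ (by omega) hi'
            obtain ⟨m₂, hm₂, h₂⟩ := ih j' (by omega) hj'
            exact ⟨_, by omega, (hi.trans (h₁.append_left _)).trans h₂⟩

theorem Equi.cancel_left (hcd : c ≠ d) (p : List α) {u v : List α}
    (h : Equi (c :: ltail) (d :: rtail) (p ++ u) (p ++ v)) : Equi (c :: ltail) (d :: rtail) u v := by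
  induction p with
  | nil => exact h
  | cons x p ih =>
    obtain ⟨k, h⟩ := h
    obtain ⟨j, -, h⟩ := h.cancel_cons hcd
    exact ih ⟨j, h⟩

/-- A word whose first letter can be changed is equivalent to one having a side of the relation as
a prefix. -/
theorem Equi.exists_prefix {x y : α} {u v : List α} (hxy : x ≠ y)
    (h : Equi (c :: ltail) (d :: rtail) (x :: u) (y :: v)) :
    (x = c ∧ ∃ s, Equi (c :: ltail) (d :: rtail) (x :: u) (c :: ltail ++ s)) ∨
      (x = d ∧ ∃ s, Equi (c :: ltail) (d :: rtail) (x :: u) (d :: rtail ++ s)) := by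
  obtain ⟨k, h⟩ := h
  rcases h.first_letter with ⟨v', hv, -⟩ | ⟨i, j, p, q, u', s, -, hpq, hu, hi, -⟩
  · exact absurd (List.cons.inj hv).1.symm hxy
  · rcases hpq with ⟨rfl, rfl⟩ | ⟨rfl, rfl⟩
    · exact .inl ⟨(List.cons.inj hu).1, s, i, hu ▸ hi.cons x⟩
    · exact .inr ⟨(List.cons.inj hu).1, s, i, hu ▸ hi.cons x⟩

/-- The `k`-th power of a word. -/
def wordPow (w : List α) : ℕ → List α
  | 0 => []
  | k + 1 => w ++ wordPow w k

theorem wordPow_add (w : List α) (i j : ℕ) :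
    wordPow w (i + j) = wordPow w i ++ wordPow w j := by
  induction i with
  | zero => simp [wordPow]
  | succ i ih => rw [Nat.add_right_comm, wordPow, ih, wordPow, List.append_assoc]

end Rewriting

/-- Equivalence of reversed words in `T_{n+1}`: it identifies `(ba)^(n+1)(ab)` with
`(ab)^(n+1)`. -/
abbrev RevEqui (n : ℕ) : List (Fin 2) → List (Fin 2) → Prop :=
  Equi (1 :: 0 :: (wordPow [1, 0] n ++ [0, 1])) (0 :: 1 :: wordPow [0, 1] n)

theorem revEqui_rel (n : ℕ) :
    RevEqui n (wordPow [1, 0] (n + 1) ++ [0, 1]) (wordPow [0, 1] (n + 1)) := Equi.of_rel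

theorem RevEqui.cancel_left {n : ℕ} (p : List (Fin 2)) {u v : List (Fin 2)}
    (h : RevEqui n (p ++ u) (p ++ v)) : RevEqui n u v :=
  Equi.cancel_left (by decide) p h

theorem not_revEqui_nil_cons (n : ℕ) (x : Fin 2) (v : List (Fin 2)) :
    ¬ RevEqui n [] (x :: v) := fun ⟨_, h⟩ => by
  simpa using h.eq_of_nil (by simp) (by simp)

theorem RevEqui.exists_prefix_one {n : ℕ} {u v : List (Fin 2)}
    (h : RevEqui n (1 :: u) (0 :: v)) :
    ∃ s, RevEqui n (1 :: u) (wordPow [1, 0] (n + 1) ++ ([0, 1] ++ s)) := by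
  rcases Equi.exists_prefix (by decide) h with ⟨-, s, hs⟩ | ⟨h, -⟩
  · exact ⟨s, by simpa [wordPow] using hs⟩
  · exact absurd h (by decide)

theorem RevEqui.exists_prefix_zero {n : ℕ} {u v : List (Fin 2)}
    (h : RevEqui n (0 :: u) (1 :: v)) :
    ∃ s, RevEqui n (0 :: u) (wordPow [0, 1] (n + 1) ++ s) := by
  rcases Equi.exists_prefix (by decide) h with ⟨h, -⟩ | ⟨-, s, hs⟩
  · exact absurd h (by decide)
  · exact ⟨s, by simpa [wordPow] using hs⟩

/-- For `0 < j ≤ n`, a word equivalent to `(ba)^j(ab)^(k+1)` does not start with `a`. -/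
theorem not_revEqui_zero_cons_of_le {n j : ℕ} (hj : 0 < j) (hjn : j ≤ n) (k : ℕ)
    (v : List (Fin 2)) :
    ¬ RevEqui n (wordPow [1, 0] j ++ wordPow [0, 1] (k + 1)) (0 :: v) := by
  induction k using Nat.strong_induction_on generalizing v with
  | _ k ih =>
    intro h
    obtain ⟨i, rfl⟩ : ∃ i, j = i + 1 := ⟨j - 1, by omega⟩
    obtain ⟨s, hs⟩ : ∃ s, RevEqui n (wordPow [1, 0] (i + 1) ++ wordPow [0, 1] (k + 1))
        (wordPow [1, 0] (n + 1) ++ ([0, 1] ++ s)) := RevEqui.exists_prefix_one h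
    rcases lt_or_ge k n with hk | hk
    · have hn : n + 1 = (i + 1) + ((n - i - 1) + 1) := by omega
      rw [hn, wordPow_add [1, 0] (i + 1), List.append_assoc] at hs
      obtain ⟨t, ht⟩ : ∃ t, RevEqui n (wordPow [0, 1] (k + 1)) (wordPow [0, 1] (n + 1) ++ t) :=
        RevEqui.exists_prefix_zero hs.cancel_left
      have hn : n + 1 = (k + 1) + ((n - k - 1) + 1) := by omega
      rw [hn, wordPow_add [0, 1] (k + 1) (_ + 1), List.append_assoc,
        ← List.append_nil (wordPow [0, 1] (k + 1)), List.append_assoc] at ht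
      exact not_revEqui_nil_cons n _ _ ht.cancel_left
    · obtain ⟨e, rfl⟩ := Nat.exists_eq_add_of_le hk
      have key : RevEqui n (wordPow [1, 0] (n + 1) ++
            (wordPow [1, 0] (i + 1) ++ wordPow [0, 1] (e + 1)))
          (wordPow [1, 0] (i + 1) ++ wordPow [0, 1] (n + e + 1)) := by
        have := ((Equi.refl (wordPow [1, 0] (i + 1))).append (revEqui_rel n)).append
          (Equi.refl (wordPow [0, 1] e))
        rw [Nat.add_right_comm n e 1, wordPow_add [0, 1] (n + 1) e, ← List.append_assoc,
          ← wordPow_add, Nat.add_comm (n + 1) (i + 1), wordPow_add]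
        simpa [wordPow] using this
      exact ih e (by omega) _ (RevEqui.cancel_left _ (key.trans hs))

/-- If `n + 1` does not divide `j`, then a word equivalent to `(ba)^j(ab)^(k+1)` does not start
with `a`. -/
theorem not_revEqui_zero_cons {n j : ℕ} (hj : ¬ (n + 1) ∣ j) (k : ℕ) (v : List (Fin 2)) :
    ¬ RevEqui n (wordPow [1, 0] j ++ wordPow [0, 1] (k + 1)) (0 :: v) := by
  induction j using Nat.strong_induction_on generalizing k with
  | _ j ih =>
    rcases le_or_gt j n with hjn | hjn
    · exact not_revEqui_zero_cons_of_le (Nat.pos_of_ne_zero (by rintro rfl; simp at hj)) hjn k v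
    · obtain ⟨e, rfl⟩ : ∃ e, j = e + (n + 1) := ⟨j - (n + 1), by omega⟩
      intro h
      have key := ((Equi.refl (wordPow [1, 0] e)).append (revEqui_rel n)).append
        (Equi.refl (wordPow [0, 1] k))
      refine ih e (by omega) (by simpa using hj) (n + k) (Equi.trans ?_ h)
      rw [Nat.add_right_comm n k 1, wordPow_add [0, 1] (n + 1) k, wordPow_add [1, 0] e,
        wordPow.eq_2 _ k]
      simpa only [List.append_assoc] using key.symm

/-- The reversed list of letters of an element of the free semigroup. -/
def revWord (x : FreeSemigroup (Fin 2)) : List (Fin 2) := (x.head :: x.tail).reverse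

theorem revWord_mul (x y : FreeSemigroup (Fin 2)) :
    revWord (x * y) = revWord y ++ revWord x := by
  simp [revWord]

theorem revWord_sPow (x : FreeSemigroup (Fin 2)) (k : ℕ) :
    revWord (sPow x k) = wordPow (revWord x) (k + 1) := by
  induction k with
  | zero => simp [sPow, wordPow]
  | succ k ih => rw [sPow, revWord_mul, ih, ← wordPow]

theorem revWord_a_mul_b : revWord (a * b) = [1, 0] := rfl

theorem revWord_b_mul_a : revWord (b * a) = [0, 1] := rfl

/-- Equivalence of reversed words as a congruence on the free semigroup. -/
def revCon (n : ℕ) : Con (FreeSemigroup (Fin 2)) where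
  r x y := RevEqui n (revWord x) (revWord y)
  iseqv := ⟨fun _ => .refl _, .symm, .trans⟩
  mul' h h' := by
    rw [revWord_mul, revWord_mul]
    exact h'.append h

theorem conGen_rel_le_revCon (n : ℕ) : conGen (rel (n + 1)) ≤ revCon n := by
  refine Con.conGen_le.2 ?_
  rintro _ _ ⟨rfl, rfl⟩
  change RevEqui n _ _
  rw [revWord_mul, revWord_sPow, revWord_sPow, revWord_a_mul_b, revWord_b_mul_a]
  exact revEqui_rel n

theorem map_sPow {S S' : Type*} [Semigroup S] [Semigroup S'] (f : S →ₙ* S') (x : S) (k : ℕ) :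
    f (sPow x k) = sPow (f x) k := by
  induction k with
  | zero => rfl
  | succ k ih => rw [sPow, map_mul, ih, sPow]

/-- The quotient map from the free semigroup to `T n`. -/
def toT (n : ℕ) : FreeSemigroup (Fin 2) →ₙ* T n where
  toFun x := ((x : (conGen (rel n)).Quotient) : T n)
  map_mul' _ _ := rfl

theorem toT_eq_iff {n : ℕ} {x y : FreeSemigroup (Fin 2)} :
    toT n x = toT n y ↔ conGen (rel n) x y :=
  Con.eq _

/-- In `T_n = ⟨a, b ∣ (ba)(ab)^n = (ba)^n⟩` with `n ≥ 2` there are elements `x, y`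
(namely `x = a`, `y = b`) with `(y*x)*(x*y)^n = (y*x)^n` and
`(y*x)²*(x*y)^m ≠ (y*x)*(x*y)^m*(y*x)` for every positive `m < n² + 2n` with `n ∤ m`. -/
theorem T_n_witness (n : ℕ) (hn : 2 ≤ n) :
    ∃ x y : T n,
      (y * x) * sPow (x * y) (n - 1) = sPow (y * x) (n - 1) ∧
      ∀ m : ℕ, 0 < m → m < n ^ 2 + 2 * n → ¬ n ∣ m →
        (y * x) * (y * x) * sPow (x * y) (m - 1) ≠
          (y * x) * sPow (x * y) (m - 1) * (y * x) := by
  refine ⟨toT n a, toT n b, ?_, fun m hm _ hnm => ?_⟩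
  · simp only [← map_mul, ← map_sPow]
    exact toT_eq_iff.2 (.of _ _ ⟨rfl, rfl⟩)
  · simp only [← map_mul, ← map_sPow]
    intro h
    obtain ⟨k, rfl⟩ : ∃ k, n = k + 1 := ⟨n - 1, by omega⟩
    obtain ⟨j, rfl⟩ : ∃ j, m = j + 1 := ⟨m - 1, by omega⟩
    have h : RevEqui k _ _ := conGen_rel_le_revCon k (toT_eq_iff.1 h)
    simp only [revWord_mul _ (b * a), revWord_mul _ (sPow _ _), revWord_sPow, revWord_a_mul_b,
      revWord_b_mul_a, Nat.add_sub_cancel] at h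
    exact not_revEqui_zero_cons hnm 1 _ h

end Stmt10
end

section
/- For every n ≥ 2, the semigroup T_n presented by ⟨a, b | (b*a)*(a*b)^n = (b*a)^n⟩ is not LEF. -/
namespace Stmt11

/-- A semigroup `S` is LEF if for every finite subset `H` of `S` there exist a finite
semigroup `F` and a function `f : S → F` injective on `H` such that
`f (x * y) = f x * f y` whenever `x, y, x * y ∈ H`. -/
def IsLEF (S : Type*) [Semigroup S] : Prop :=
  ∀ H : Finset S, ∃ (F : Type) (_ : Semigroup F) (_ : Fintype F) (f : S → F),
    Set.InjOn f ↑H ∧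
      ∀ x ∈ H, ∀ y ∈ H, x * y ∈ H → f (x * y) = f x * f y

/-- Positive powers in a semigroup: `sPow x n = x ^ (n + 1)`, so that for `k ≥ 1` the
`k`-th power `x ^ k` is `sPow x (k - 1)`. -/
def sPow {S : Type*} [Semigroup S] (x : S) : ℕ → S
  | 0 => x
  | n + 1 => sPow x n * x

/-- The generator `a` of the free semigroup on two generators. -/
def a : FreeSemigroup (Fin 2) := FreeSemigroup.of 0

/-- The generator `b` of the free semigroup on two generators. -/
def b : FreeSemigroup (Fin 2) := FreeSemigroup.of 1

/-- The defining relation `(b*a)*(a*b)^n = (b*a)^n`. -/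
def rel (n : ℕ) : FreeSemigroup (Fin 2) → FreeSemigroup (Fin 2) → Prop :=
  fun x y => x = (b * a) * sPow (a * b) (n - 1) ∧ y = sPow (b * a) (n - 1)

/-- The semigroup `T_n = ⟨a, b ∣ (ba)(ab)^n = (ba)^n⟩`. -/
def T (n : ℕ) : Type := (conGen (rel n)).Quotient

instance (n : ℕ) : Semigroup (T n) := Con.semigroup _

/-- A finite monoid has a positive exponent `N` for which every `N`-th power is idempotent. -/
theorem exists_pow_idempotent (M : Type*) [Monoid M] [Finite M] :
    ∃ N : ℕ, 0 < N ∧ ∀ z : M, IsIdempotentElem (z ^ N) := by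
  obtain ⟨i, j, hne, hij⟩ :=
    Finite.exists_ne_map_eq_of_infinite (fun (i : ℕ) (z : M) => z ^ i)
  wlog hlt : i < j generalizing i j
  · exact this j i hne.symm hij.symm (by omega)
  obtain ⟨p, rfl⟩ := Nat.exists_eq_add_of_lt hlt
  have step (z : M) (k t : ℕ) (hk : i ≤ k) : z ^ (k + t * (p + 1)) = z ^ k := by
    obtain ⟨d, rfl⟩ := Nat.exists_eq_add_of_le hk
    induction t with
    | zero => simp
    | succ t ih =>
      have hz : z ^ i = z ^ (i + p + 1) := congrFun hij z
      calc z ^ (i + d + (t + 1) * (p + 1))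
          = z ^ (i + p + 1) * z ^ (d + t * (p + 1)) := by rw [← pow_add]; congr 1; ring
        _ = z ^ (i + d + t * (p + 1)) := by rw [← hz, ← pow_add, add_assoc]
        _ = z ^ (i + d) := ih
  refine ⟨(i + 1) * (p + 1), by positivity, fun z => ?_⟩
  rw [IsIdempotentElem, ← pow_add]
  exact step z _ _ (by nlinarith)

section Monoid

variable {M : Type*} [Monoid M]

theorem mul_pow_mul_comm (u v : M) (k : ℕ) : (u * v) ^ k * u = u * (v * u) ^ k := by
  induction k with
  | zero => simp
  | succ k ih => rw [pow_succ', mul_assoc, ih, pow_succ']; simp only [mul_assoc]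

theorem mul_pow_succ_eq (u v : M) (k : ℕ) : (u * v) ^ (k + 1) = u * (v * u) ^ k * v := by
  rw [pow_succ, ← mul_assoc, mul_pow_mul_comm]

/-- If `y * x ^ (k + 1) = y ^ (k + 1)`, then `y ^ (j * k + 1) = y * x ^ (j * (k + 1))`. -/
theorem pow_eq_mul_pow_of_rel {x y : M} {k : ℕ} (h : y * x ^ (k + 1) = y ^ (k + 1)) (j : ℕ) :
    y ^ (j * k + 1) = y * x ^ (j * (k + 1)) := by
  induction j with
  | zero => simp
  | succ j ih =>
    calc y ^ ((j + 1) * k + 1) = y ^ (j * k) * y ^ (k + 1) := by rw [← pow_add]; congr 1; ring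
      _ = y ^ (j * k + 1) * x ^ (k + 1) := by rw [← h, pow_succ y (j * k), mul_assoc]
      _ = y * x ^ ((j + 1) * (k + 1)) := by rw [ih, mul_assoc, ← pow_add]; congr 2; ring

theorem eq_pow_mul_pow_of_eq {c p q : M} (h : c = p * c * q) (t : ℕ) : c = p ^ t * c * q ^ t := by
  induction t with
  | zero => simp
  | succ t ih =>
    calc c = p ^ t * (p * c * q) * q ^ t := by rw [← h]; exact ih
      _ = p ^ (t + 1) * c * q ^ (t + 1) := by rw [pow_succ, pow_succ']; simp only [mul_assoc]

theorem pow_mul_eq_of_eq_mul_mul {c p q : M} (h : c = p * c * q) {N : ℕ}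
    (hN : IsIdempotentElem (p ^ N)) : p ^ N * c = c := by
  have hc := eq_pow_mul_pow_of_eq h N
  calc p ^ N * c = p ^ N * p ^ N * c * q ^ N := by
        conv_lhs => rw [hc]
        simp only [mul_assoc]
    _ = c := by rw [hN.eq, ← hc]

theorem pow_mul_idempotent_eq {y z : M} {m N : ℕ}
    (hy : IsIdempotentElem (y ^ N)) (h : y ^ m = z * y * y ^ m) : y ^ m * y ^ N = y ^ m := by
  have hz (t : ℕ) : y ^ m = z ^ t * y ^ (m + t) := by
    induction t with
    | zero => simp
    | succ t ih =>
      calc y ^ m = z ^ t * (y ^ m * y ^ t) := by rw [← pow_add]; exact ih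
        _ = z ^ t * (z * y * y ^ m * y ^ t) := by rw [← h]
        _ = z ^ (t + 1) * (y ^ 1 * y ^ m * y ^ t) := by
          rw [pow_succ, pow_one]; simp only [mul_assoc]
        _ = z ^ (t + 1) * y ^ (m + (t + 1)) := by
          rw [← pow_add, ← pow_add]; congr 2; ring
  calc y ^ m * y ^ N = z ^ N * (y ^ m * (y ^ N * y ^ N)) := by
        conv_lhs => rw [hz N, pow_add]
        simp only [mul_assoc]
    _ = y ^ m := by rw [hy.eq, ← pow_add, ← hz]

/-- In a finite monoid, the relation `(ba)(ab)^n = (ba)^n` (with `n = k + 1`) forces, for `n ≥ 2`,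
`(ab)^(3n-1) (ba)^(n-1) = (ab)^(3n-1) (ab)^n`. -/
theorem pow_mul_pow_eq_of_finite [Finite M] {a b : M} {k : ℕ} (hk : 0 < k)
    (h : b * a * (a * b) ^ (k + 1) = (b * a) ^ (k + 1)) :
    (a * b) ^ (3 * k + 2) * (b * a) ^ k = (a * b) ^ (3 * k + 2) * (a * b) ^ (k + 1) := by
  obtain ⟨N, hN, idem⟩ := exists_pow_idempotent M
  obtain ⟨r, rfl⟩ := Nat.exists_eq_add_of_lt hN
  rw [zero_add] at idem
  have hrel := pow_eq_mul_pow_of_rel h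
  have hxy := mul_pow_succ_eq a b
  have hyb := mul_pow_mul_comm b a
  set x := a * b with hx
  set y := b * a with hy
  have hreg : y ^ (3 * k + 1) = y * a * y * y ^ (3 * k + 1) * b := by
    calc y ^ (3 * k + 1) = y * x ^ (3 * k + 2 + 1) := by rw [hrel 3]; congr 2
      _ = y * a * (y * y ^ (3 * k + 1)) * b := by
        rw [hxy, pow_succ' y (3 * k + 1)]; simp only [mul_assoc]
      _ = _ := by simp only [mul_assoc]
  have hyN : y ^ (3 * k + 1) * y ^ (r + 1) = y ^ (3 * k + 1) := by
    refine pow_mul_idempotent_eq (z := (y * a * y) ^ r * (y * a)) (idem y) ?_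
    rw [mul_assoc ((y * a * y) ^ r), ← pow_succ]
    exact (pow_mul_eq_of_eq_mul_mul hreg (idem _)).symm
  have hxN : x ^ (3 * k + 2) * x ^ (r + 1) = x ^ (3 * k + 2) := by
    rw [hxy (3 * k + 1), mul_assoc, ← hyb, ← mul_assoc, mul_assoc a, hyN]
  have idem_mul (z : M) (t : ℕ) : z ^ ((r + 1) * (t + 1)) = z ^ (r + 1) := by
    rw [pow_mul, (idem z).pow_succ_eq]
  have hef : y ^ (r + 1) = y ^ (r + 1) * x ^ (r + 1) := by
    have h1 := hrel (r + 1)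
    rw [idem_mul x, pow_succ', ← Nat.sub_add_cancel hk, idem_mul y] at h1
    calc y ^ (r + 1) = y ^ r * (y * y ^ (r + 1)) := by
          rw [← mul_assoc, ← pow_succ, (idem y).eq]
      _ = y ^ (r + 1) * x ^ (r + 1) := by rw [h1, ← mul_assoc, ← pow_succ]
  have hfe : x ^ (r + 1) * y ^ (r + 1) = x ^ (r + 1) := by
    have hf : x ^ (r + 1) = a * y ^ (r + 1) * x ^ (r + 1) * (y ^ r * b) := by
      rw [mul_assoc a, ← hef]
      calc x ^ (r + 1) = x ^ (r + 1) * x ^ (r + 1) := (idem x).eq.symm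
        _ = a * (y ^ r * y * y ^ r) * b := by
          rw [hxy r, hy]; simp only [mul_assoc]
        _ = _ := by rw [← pow_succ]; simp only [mul_assoc]
    have h2 := pow_mul_eq_of_eq_mul_mul hf (idem _)
    have h3 : x ^ (r + 1) = (a * y ^ (r + 1)) ^ (r + 1) := by
      rw [← h2, pow_succ, mul_assoc, mul_assoc a, ← hef]
    rw [h3, pow_succ, mul_assoc, mul_assoc a, (idem y).eq]
  have he : y ^ (r + 1) * y ^ k = y ^ (r + 1) * x ^ (k + 1) := by
    rw [pow_succ, mul_assoc, ← pow_succ', ← h, ← mul_assoc]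
  calc x ^ (3 * k + 2) * y ^ k
      = x ^ (3 * k + 2) * (x ^ (r + 1) * y ^ (r + 1)) * y ^ k := by rw [hfe, hxN]
    _ = x ^ (3 * k + 2) * (x ^ (r + 1) * y ^ (r + 1)) * x ^ (k + 1) := by
      simp only [mul_assoc, he]
    _ = x ^ (3 * k + 2) * x ^ (k + 1) := by rw [hfe, hxN]

end Monoid

theorem map_sPow {S R : Type*} [Semigroup S] [Semigroup R] (φ : S →ₙ* R) (x : S) (k : ℕ) :
    φ (sPow x k) = sPow (φ x) k := by
  induction k with
  | zero => rfl
  | succ k ih => simp only [sPow, map_mul, ih]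

theorem sPow_eq_pow {M : Type*} [Monoid M] (x : M) (k : ℕ) : sPow x k = x ^ (k + 1) := by
  induction k with
  | zero => simp [sPow]
  | succ k ih => rw [sPow, ih, ← pow_succ]

theorem finite_length_le (α : Type*) [Finite α] (L : ℕ) :
    {w : FreeSemigroup α | w.length ≤ L}.Finite := by
  refine Set.Finite.of_injOn (f := fun w => (w.head, w.tail))
    (t := Set.univ ×ˢ {l : List α | l.length ≤ L}) ?_ ?_
    (Set.finite_univ.prod (List.finite_length_le α L))
  · intro w hw
    simp only [FreeSemigroup.length, Set.mem_ofPred_eq] at hw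
    simp only [Set.mem_prod, Set.mem_univ, Set.mem_ofPred_eq, true_and]
    omega
  · intro v _ w _ hvw
    exact FreeSemigroup.ext (congrArg Prod.fst hvw) (congrArg Prod.snd hvw)

/-- A semigroup homomorphism out of a free semigroup of finite rank into an LEF semigroup can be
approximated, on words of bounded length, by a homomorphism into a finite semigroup. -/
theorem IsLEF.exists_hom {S : Type*} [Semigroup S] (hS : IsLEF S) {α : Type*} [Finite α]
    (π : FreeSemigroup α →ₙ* S) (L : ℕ) :
    ∃ (F : Type) (_ : Semigroup F) (_ : Finite F) (φ : FreeSemigroup α →ₙ* F),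
      ∀ v w : FreeSemigroup α, v.length ≤ L → w.length ≤ L → (φ v = φ w ↔ π v = π w) := by
  classical
  obtain ⟨F, _, _, f, hinj, hmul⟩ := hS ((finite_length_le α L).toFinset.image π)
  have mem {w : FreeSemigroup α} (hw : w.length ≤ L) :
      π w ∈ (finite_length_le α L).toFinset.image π :=
    Finset.mem_image_of_mem _ (by simpa using hw)
  let φ : FreeSemigroup α →ₙ* F := FreeSemigroup.lift fun i => f (π (FreeSemigroup.of i))
  have agree (i : α) (l : List α) (hl : l.length + 1 ≤ L) : φ ⟨i, l⟩ = f (π ⟨i, l⟩) := by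
    induction l using List.reverseRecOn with
    | nil => rfl
    | append_singleton l j ih =>
      rw [List.length_append, List.length_singleton] at hl
      have hsplit : (⟨i, l ++ [j]⟩ : FreeSemigroup α) = ⟨i, l⟩ * FreeSemigroup.of j := rfl
      rw [hsplit, map_mul, map_mul, ih (by omega), hmul]
      · rfl
      · exact mem (by simp only [FreeSemigroup.length]; omega)
      · exact mem (by simp only [FreeSemigroup.length_of]; omega)
      · rw [← map_mul, ← hsplit]
        exact mem (by simpa [FreeSemigroup.length] using hl)
  refine ⟨F, inferInstance, inferInstance, φ, fun v w hv hw => ?_⟩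
  rw [agree v.head v.tail hv, agree w.head w.tail hw]
  exact ⟨fun h => hinj (mem hv) (mem hw) h, fun h => congrArg f h⟩

/-- The action of the free semigroup on `ℕ` in which `a` is the predecessor and `b` the successor
map; it factors through the bicyclic monoid. -/
def bicyclicAction : FreeSemigroup (Fin 2) →ₙ* Function.End ℕ :=
  FreeSemigroup.lift ![Nat.pred, Nat.succ]

theorem bicyclicAction_ab : bicyclicAction (a * b) = 1 := by
  funext m
  rfl

theorem isIdempotentElem_bicyclicAction_ba : IsIdempotentElem (bicyclicAction (b * a)) := by
  funext m
  rfl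

theorem bicyclicAction_ba_ne_one : bicyclicAction (b * a) ≠ 1 := by
  intro h
  exact absurd (congrFun h 0) Nat.one_ne_zero

theorem bicyclicAction_eq_of_conGen {n : ℕ} {v w : FreeSemigroup (Fin 2)}
    (h : conGen (rel n) v w) : bicyclicAction v = bicyclicAction w := by
  have hle : conGen (rel n) ≤ Con.ker bicyclicAction := by
    refine Con.conGen_le.2 ?_
    rintro _ _ ⟨rfl, rfl⟩
    rw [Con.ker_rel, map_mul _ (b * a), map_sPow, map_sPow, sPow_eq_pow, sPow_eq_pow,
      bicyclicAction_ab, one_pow, mul_one, isIdempotentElem_bicyclicAction_ba.pow_succ_eq]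
  exact hle h

/-- For every `n ≥ 2` the semigroup `T_n = ⟨a, b ∣ (ba)(ab)^n = (ba)^n⟩` is not LEF. -/
theorem T_n_not_isLEF (n : ℕ) (hn : 2 ≤ n) : ¬ IsLEF (T n) := by
  intro hLEF
  obtain ⟨k, rfl⟩ := Nat.exists_eq_add_of_le' hn
  let π : FreeSemigroup (Fin 2) →ₙ* T (k + 2) :=
    { toFun := fun w => (w : (conGen (rel (k + 2))).Quotient)
      map_mul' := fun _ _ => rfl }
  have hπ {v w : FreeSemigroup (Fin 2)} : π v = π w ↔ conGen (rel (k + 2)) v w := Con.eq _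
  let u₁ := b * a * sPow (a * b) (k + 1)
  let u₂ := sPow (b * a) (k + 1)
  let w₁ := sPow (a * b) (3 * k + 4) * sPow (b * a) k
  let w₂ := sPow (a * b) (3 * k + 4) * sPow (a * b) (k + 1)
  obtain ⟨F, _, _, φ, hφ⟩ :=
    hLEF.exists_hom π (u₁.length + u₂.length + w₁.length + w₂.length)
  let ψ : FreeSemigroup (Fin 2) →ₙ* WithOne F := WithOne.coeMulHom.comp φ
  have hψ {v w : FreeSemigroup (Fin 2)} : ψ v = ψ w ↔ φ v = φ w := WithOne.coe_inj
  have hu : ψ u₁ = ψ u₂ := by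
    rw [hψ, hφ _ _ (by omega) (by omega), hπ]
    exact ConGen.Rel.of _ _ ⟨rfl, rfl⟩
  have : Finite (WithOne F) := inferInstanceAs (Finite (Option F))
  have hw : ψ w₁ = ψ w₂ := by
    simp only [u₁, u₂, map_mul, map_sPow, sPow_eq_pow] at hu
    simp only [w₁, w₂, map_mul, map_sPow, sPow_eq_pow]
    exact pow_mul_pow_eq_of_finite k.succ_pos hu
  rw [hψ, hφ _ _ (by omega) (by omega), hπ] at hw
  have h := bicyclicAction_eq_of_conGen hw
  simp only [w₁, w₂, map_mul _ (sPow _ _), map_sPow, sPow_eq_pow, bicyclicAction_ab, one_pow,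
    one_mul, isIdempotentElem_bicyclicAction_ba.pow_succ_eq] at h
  exact bicyclicAction_ba_ne_one h

end Stmt11
end
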